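/- Let T ∈ M_{m,n}(F_q) be a matrix of rank one and 0 ≤ k ≤ m ≤ n. Then the number of rank-k matrices A ∈ M_{m,n}(F_q) with trace(Tᵀ A) = 0 equals ((q^{m−1} − 1)(q^n − 1) + (q^{n−k} − 1)(q − 1)q^{m−1}) · (#Γ_{n,k} · #Γ_{m,k} · #GL_k) / ((q^n − 1)(q^m − 1)). -/

import Mathlib

open Matrix
open scoped BigOperators

/-- The number of `k`-dimensional `F`-subspaces of `F^n` (the Grassmannian cardinality `#Γ_{n,k}`). -/
noncomputable def grassCard (F : Type) [Field F] [Fintype F] (n k : ℕ) : ℕ :=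
  Nat.card {W : Submodule F (Fin n → F) // Module.finrank F W = k}

/-- The order of `GL_k(F_q)`, namely `∏_{a=0}^{k-1} (q^k − q^a)`. -/
def cardGL (q k : ℕ) : ℕ := ∏ a ∈ Finset.range k, (q ^ k - q ^ a)

/-- Invertible matrices act transitively on nonzero vectors. -/
theorem exists_isUnit_det_mulVec_eq {F : Type} [Field F] {n : ℕ} {u v : Fin n → F}
    (hu : u ≠ 0) (hv : v ≠ 0) : ∃ P : Matrix (Fin n) (Fin n) F, IsUnit P.det ∧ P *ᵥ u = v := by
  let e := (LinearEquiv.toSpanNonzeroSingleton F (Fin n → F) u hu).symm ≪≫ₗ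
    LinearEquiv.toSpanNonzeroSingleton F (Fin n → F) v hv
  obtain ⟨g, hg⟩ := Submodule.exists_linearEquiv_restrict_eq e
  refine ⟨LinearMap.toMatrix' (g : (Fin n → F) →ₗ[F] (Fin n → F)), ?_, ?_⟩
  · rw [LinearMap.det_toMatrix']
    exact LinearEquiv.isUnit_det' g
  · have h := hg ⟨u, Submodule.mem_span_singleton_self u⟩
    have hu' : (LinearEquiv.toSpanNonzeroSingleton F (Fin n → F) u hu).symm
        ⟨u, Submodule.mem_span_singleton_self u⟩ = 1 := by
      rw [LinearEquiv.symm_apply_eq]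
      ext1
      simp
    rw [← Matrix.toLin'_apply, Matrix.toLin'_toMatrix', LinearEquiv.coe_coe]
    simpa [e, hu'] using h.symm

theorem Matrix.exists_eq_vecMulVec_of_rank_eq_one {F : Type} [Field F] {m n : ℕ}
    {T : Matrix (Fin m) (Fin n) F} (hT : T.rank = 1) :
    ∃ u v, u ≠ 0 ∧ v ≠ 0 ∧ T = vecMulVec u v := by
  obtain ⟨⟨u, hu⟩, -, h⟩ := finrank_eq_one_iff'.mp hT
  have hcol : ∀ j, ∃ c : F, c • u = T.col j := fun j => by
    obtain ⟨c, hc⟩ := h ⟨T.col j, Pi.single j 1, by simp⟩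
    exact ⟨c, congrArg Subtype.val hc⟩
  choose v hv using hcol
  have hTuv : T = vecMulVec u v := by
    ext i j
    have := congrFun (hv j) i
    simp only [Pi.smul_apply, smul_eq_mul, col_apply] at this
    rw [← this, vecMulVec_apply, mul_comm]
  refine ⟨u, v, ?_, ?_, hTuv⟩
  · rintro rfl
    simp [hTuv] at hT
  · rintro rfl
    have hT0 : T = 0 := by
      ext
      simp [hTuv, vecMulVec_apply]
    simp [hT0] at hT

theorem Matrix.trace_transpose_vecMulVec_mul {F : Type} [Field F] {m n : ℕ}
    (u : Fin m → F) (v : Fin n → F) (A : Matrix (Fin m) (Fin n) F) :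
    ((vecMulVec u v)ᵀ * A).trace = u ⬝ᵥ A *ᵥ v := by
  rw [transpose_vecMulVec, vecMulVec_mul, trace_vecMulVec, dotProduct_comm, dotProduct_mulVec]

theorem card_rank_dotProduct_le {F : Type} [Field F] [Fintype F] {m n : ℕ} (k : ℕ)
    {u u' : Fin m → F} {v v' : Fin n → F} (hu : u ≠ 0) (hu' : u' ≠ 0) (hv : v ≠ 0) (hv' : v' ≠ 0) :
    Nat.card {A : Matrix (Fin m) (Fin n) F // A.rank = k ∧ u ⬝ᵥ A *ᵥ v = 0} ≤
      Nat.card {A : Matrix (Fin m) (Fin n) F // A.rank = k ∧ u' ⬝ᵥ A *ᵥ v' = 0} := by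
  obtain ⟨P, hP, rfl⟩ := exists_isUnit_det_mulVec_eq hu' hu
  obtain ⟨Q, hQ, rfl⟩ := exists_isUnit_det_mulVec_eq hv' hv
  have hP' : IsUnit Pᵀ.det := by rwa [det_transpose]
  refine Nat.card_le_card_of_injective (fun A => ⟨Pᵀ * A.1 * Q, ?_, ?_⟩) fun A B h => ?_
  · rw [rank_mul_eq_left_of_isUnit_det _ _ hQ, rank_mul_eq_right_of_isUnit_det _ _ hP', A.2.1]
  · rw [← mulVec_mulVec, ← mulVec_mulVec, dotProduct_mulVec, vecMul_transpose]
    exact A.2.2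
  · have h' := congrArg Subtype.val h
    dsimp only at h'
    have := P.invertibleOfIsUnitDet hP
    have := Q.invertibleOfIsUnitDet hQ
    exact Subtype.ext <| (Matrix.mul_right_inj_of_invertible Pᵀ).mp <|
      (Matrix.mul_left_inj_of_invertible Q).mp h'

theorem card_rank_eq_mul {F : Type} [Field F] [Fintype F] (m n k : ℕ) :
    Nat.card {A : Matrix (Fin m) (Fin n) F // A.rank = k} =
      grassCard F m k * Nat.card {B : Matrix (Fin k) (Fin n) F // B.rank = k} := by
  let f : {A : Matrix (Fin m) (Fin n) F // A.rank = k} →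
      {W : Submodule F (Fin m → F) // Module.finrank F W = k} :=
    fun A => ⟨LinearMap.range A.1.mulVecLin, A.2⟩
  have hfiber (W) : Nat.card {A // f A = W} =
      Nat.card {B : Matrix (Fin k) (Fin n) F // B.rank = k} := by
    obtain ⟨W, hW⟩ := W
    obtain ⟨e⟩ : Nonempty ((Fin k → F) ≃ₗ[F] W) :=
      FiniteDimensional.nonempty_linearEquiv_of_finrank_eq (by simp [hW])
    let C := LinearMap.toMatrix' (W.subtype ∘ₗ e.toLinearMap)
    have hC (x) : C *ᵥ x = e x := by
      rw [← Matrix.toLin'_apply, Matrix.toLin'_toMatrix']; rfl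
    have hrange (B : Matrix (Fin k) (Fin n) F) (hB : B.rank = k) :
        LinearMap.range (C * B).mulVecLin = W := by
      have htop : LinearMap.range B.mulVecLin = ⊤ :=
        Submodule.eq_top_of_finrank_eq (by simpa [Matrix.rank] using hB)
      rw [mulVecLin_mul, LinearMap.range_comp, htop, Submodule.map_top]
      ext x
      constructor
      · rintro ⟨y, rfl⟩
        simp [hC]
      · intro hx
        exact ⟨e.symm ⟨x, hx⟩, by simp [hC]⟩
    refine (Nat.card_eq_of_bijective (fun B : {B : Matrix (Fin k) (Fin n) F // B.rank = k} =>
      (⟨⟨C * B.1, by rw [Matrix.rank, hrange B.1 B.2, hW]⟩, Subtype.ext (hrange B.1 B.2)⟩ :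
        {A // f A = ⟨W, hW⟩})) ⟨fun B B' h => ?_, ?_⟩).symm
    · have h' : C * B.1 = C * B'.1 := congrArg (fun A => A.1.1) h
      refine Subtype.ext (Matrix.ext_of_mulVec_single fun j => e.injective (Subtype.ext ?_))
      rw [← hC, ← hC, mulVec_mulVec, mulVec_mulVec, h']
    · rintro ⟨⟨A, hA⟩, hAW⟩
      have hAW' : LinearMap.range A.mulVecLin = W := congrArg Subtype.val hAW
      have hmem (j) : A *ᵥ Pi.single j 1 ∈ W := hAW' ▸ ⟨_, rfl⟩
      let B : Matrix (Fin k) (Fin n) F := Matrix.of fun i j => e.symm ⟨_, hmem j⟩ i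
      have hCB : C * B = A := by
        refine Matrix.ext_of_mulVec_single fun j => ?_
        have hB : B *ᵥ Pi.single j 1 = e.symm ⟨_, hmem j⟩ := by
          ext i; simp [B]
        rw [← mulVec_mulVec, hB, hC, e.apply_symm_apply]
      have hB : B.rank = k := le_antisymm (by simpa using B.rank_le_card_height) <|
        hA.symm.trans_le (hCB ▸ rank_mul_le_right C B)
      exact ⟨⟨B, hB⟩, Subtype.ext (Subtype.ext hCB)⟩
  rw [← Nat.card_congr (Equiv.sigmaFiberEquiv f)]
  have := Fintype.ofFinite {W : Submodule F (Fin m → F) // Module.finrank F W = k}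
  rw [Nat.card_sigma, Finset.sum_congr rfl fun W _ => hfiber W, Finset.sum_const, smul_eq_mul,
    Finset.card_univ, ← Nat.card_eq_fintype_card, grassCard]

theorem card_rank_transpose {F : Type} [Field F] (m n k : ℕ) :
    Nat.card {A : Matrix (Fin m) (Fin n) F // A.rank = k} =
      Nat.card {A : Matrix (Fin n) (Fin m) F // A.rank = k} :=
  Nat.card_congr <| (Matrix.transposeAddEquiv _ _ F).toEquiv.subtypeEquiv fun A => by
    simp [rank_transpose]

theorem card_rank_self {F : Type} [Field F] [Fintype F] (k : ℕ) :
    Nat.card {A : Matrix (Fin k) (Fin k) F // A.rank = k} = cardGL (Fintype.card F) k := by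
  have h := card_linearIndependent (K := F) (V := Fin k → F) (k := k) (by simp)
  rw [Module.finrank_fin_fun] at h
  rw [cardGL, Finset.prod_range, ← h]
  refine Nat.card_congr (Equiv.subtypeEquivRight fun A => ?_)
  change A.rank = k ↔ LinearIndependent F A.row
  rw [linearIndependent_iff_card_eq_finrank_span, Fintype.card_fin, eq_comm,
    A.rank_eq_finrank_span_row, Set.finrank]

theorem card_rank {F : Type} [Field F] [Fintype F] (m n k : ℕ) :
    Nat.card {A : Matrix (Fin m) (Fin n) F // A.rank = k} =
      grassCard F n k * grassCard F m k * cardGL (Fintype.card F) k := by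
  rw [card_rank_eq_mul, card_rank_transpose k, card_rank_eq_mul, card_rank_self]
  ring

theorem card_dotProduct_eq_zero {F : Type} [Field F] [Fintype F] [DecidableEq F] {m : ℕ}
    {w : Fin m → F} (hw : w ≠ 0) :
    Fintype.card {u : Fin m → F // u ⬝ᵥ w = 0} = Fintype.card F ^ (m - 1) := by
  let φ : Module.Dual F (Fin m → F) := (dotProductBilin F F).flip w
  have hφ : φ ≠ 0 := fun h => hw <| by
    ext i
    simpa [φ] using LinearMap.congr_fun h (Pi.single i 1)
  have h := Module.Dual.finrank_ker_add_one_of_ne_zero hφ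
  rw [Module.finrank_fin_fun] at h
  rw [← Nat.eq_sub_of_add_eq h, ← Nat.card_eq_fintype_card, ← Nat.card_eq_fintype_card,
    ← Module.natCard_eq_pow_finrank]
  rfl

theorem card_mulVec_eq_zero {F : Type} [Field F] [Fintype F] [DecidableEq F] {m n : ℕ}
    (A : Matrix (Fin m) (Fin n) F) :
    Fintype.card {v : Fin n → F // A *ᵥ v = 0} = Fintype.card F ^ (n - A.rank) := by
  have h := LinearMap.finrank_range_add_finrank_ker A.mulVecLin
  rw [Module.finrank_fin_fun, ← Matrix.rank] at h
  rw [← Nat.eq_sub_of_add_eq' h, ← Nat.card_eq_fintype_card, ← Nat.card_eq_fintype_card,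
    ← Module.natCard_eq_pow_finrank]
  rfl

/-- The number of pairs of nonzero vectors annihilated by the bilinear form of `A`. -/
theorem card_pairs_dotProduct_mulVec_eq_zero {F : Type} [Field F] [Fintype F] [DecidableEq F]
    {m n : ℕ} (A : Matrix (Fin m) (Fin n) F) :
    ((Finset.univ.filter fun p : (Fin m → F) × (Fin n → F) =>
        (p.1 ≠ 0 ∧ p.2 ≠ 0) ∧ p.1 ⬝ᵥ A *ᵥ p.2 = 0).card : ℚ) =
      ((Fintype.card F : ℚ) ^ (n - A.rank) - 1) * ((Fintype.card F : ℚ) ^ m - 1) +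
        ((Fintype.card F : ℚ) ^ n - (Fintype.card F : ℚ) ^ (n - A.rank)) *
          ((Fintype.card F : ℚ) ^ (m - 1) - 1) := by
  have hcard : ∀ v : Fin n → F,
      ((Finset.univ.filter fun u : Fin m → F => u ≠ 0 ∧ v ≠ 0 ∧ u ⬝ᵥ A *ᵥ v = 0).card : ℚ) =
        if v = 0 then 0 else if A *ᵥ v = 0 then (Fintype.card F : ℚ) ^ m - 1
          else (Fintype.card F : ℚ) ^ (m - 1) - 1 := by
    intro v
    have herase (w : Fin m → F) :
        ((Finset.univ.filter fun u : Fin m → F => u ≠ 0 ∧ u ⬝ᵥ w = 0).card : ℚ) =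
        (Fintype.card {u : Fin m → F // u ⬝ᵥ w = 0} : ℚ) - 1 := by
      rw [Fintype.card_subtype, ← Finset.cast_card_erase_of_mem (a := 0) (by simp)]
      congr 2
      ext u
      simp
    split_ifs with hv hAv
    · simp [hv]
    · have := herase (A *ᵥ v)
      simp only [hv, ne_eq, not_false_eq_true, true_and]
      simp only [ne_eq] at this
      rw [this, hAv]
      simp
    · have := herase (A *ᵥ v)
      simp only [hv, ne_eq, not_false_eq_true, true_and]
      simp only [ne_eq] at this
      rw [this, card_dotProduct_eq_zero hAv]
      simp
  have hsum : ((Finset.univ.filter fun p : (Fin m → F) × (Fin n → F) =>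
        (p.1 ≠ 0 ∧ p.2 ≠ 0) ∧ p.1 ⬝ᵥ A *ᵥ p.2 = 0).card : ℚ) = ∑ v : Fin n → F,
      ((Finset.univ.filter fun u : Fin m → F => u ≠ 0 ∧ v ≠ 0 ∧ u ⬝ᵥ A *ᵥ v = 0).card : ℚ) := by
    simp only [Finset.card_filter, Fintype.sum_prod_type_right, and_assoc, Nat.cast_sum]
  rw [hsum, Finset.sum_congr rfl fun v _ => hcard v]
  have hsplit (a b : ℚ) (v : Fin n → F) :
      (if v = 0 then 0 else if A *ᵥ v = 0 then a else b) =
        b + (if A *ᵥ v = 0 then a - b else 0) - if v = 0 then a else 0 := by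
    by_cases hv : v = 0
    · simp [hv]
    · by_cases hAv : A *ᵥ v = 0 <;> simp [hv, hAv]
  simp only [hsplit, Finset.sum_sub_distrib, Finset.sum_add_distrib, Finset.sum_const,
    ← Finset.sum_filter, ← Fintype.card_subtype, card_mulVec_eq_zero, nsmul_eq_mul]
  simp
  ring

/-- for a rank-one matrix `T ∈ M_{m,n}(F_q)` and `0 ≤ k ≤ m ≤ n`, the number
of rank-`k` matrices `A` with `trace(Tᵀ A) = 0` equals
`((q^{m−1} − 1)(q^n − 1) + (q^{n−k} − 1)(q − 1)q^{m−1}) · #Γ_{n,k} #Γ_{m,k} #GL_k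
  / ((q^n − 1)(q^m − 1))`. -/
theorem card_rank_trace_zero (F : Type) [Field F] [Fintype F]
    (m n k : ℕ) (hkm : k ≤ m) (hmn : m ≤ n)
    (T : Matrix (Fin m) (Fin n) F) (hT : T.rank = 1) :
    (Nat.card {A : Matrix (Fin m) (Fin n) F // A.rank = k ∧ (Tᵀ * A).trace = 0} : ℚ) =
      (((Fintype.card F : ℚ) ^ (m - 1) - 1) * ((Fintype.card F : ℚ) ^ n - 1)
        + ((Fintype.card F : ℚ) ^ (n - k) - 1) * ((Fintype.card F : ℚ) - 1)
            * (Fintype.card F : ℚ) ^ (m - 1)) *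
      ((grassCard F n k * grassCard F m k * cardGL (Fintype.card F) k : ℕ) /
        (((Fintype.card F : ℚ) ^ n - 1) * ((Fintype.card F : ℚ) ^ m - 1))) := by
  classical
  obtain ⟨u₀, v₀, hu₀, hv₀, rfl⟩ := exists_eq_vecMulVec_of_rank_eq_one hT
  simp only [trace_transpose_vecMulVec_mul]
  set q : ℚ := (Fintype.card F : ℚ) with hq
  set c := Nat.card {A : Matrix (Fin m) (Fin n) F // A.rank = k ∧ u₀ ⬝ᵥ A *ᵥ v₀ = 0} with hc
  rw [← card_rank]
  set s := Finset.univ.filter fun A : Matrix (Fin m) (Fin n) F => A.rank = k with hs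
  set t := Finset.univ.filter fun p : (Fin m → F) × (Fin n → F) => p.1 ≠ 0 ∧ p.2 ≠ 0 with ht
  have hscard : Nat.card {A : Matrix (Fin m) (Fin n) F // A.rank = k} = s.card := by
    rw [Nat.card_eq_fintype_card, Fintype.card_subtype]
  have htcard : (t.card : ℚ) = (q ^ n - 1) * (q ^ m - 1) := by
    have : t = (Finset.univ.erase 0) ×ˢ (Finset.univ.erase 0) := by
      ext p; simp [ht]
    rw [this, Finset.card_product, Nat.cast_mul, Finset.cast_card_erase_of_mem (by simp),
      Finset.cast_card_erase_of_mem (by simp)]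
    simp [hq, mul_comm]
  have hm : 1 ≤ m := Nat.one_le_iff_ne_zero.mpr fun h => hu₀ <| by
    subst h
    exact Subsingleton.elim _ _
  have hq1 : 1 < q := by
    rw [hq]; exact_mod_cast Fintype.one_lt_card
  have hqn : q ^ n - 1 ≠ 0 := (sub_pos.mpr (one_lt_pow₀ hq1 (by omega))).ne'
  have hqm : q ^ m - 1 ≠ 0 := (sub_pos.mpr (one_lt_pow₀ hq1 (by omega))).ne'
  have habove (A) (hA : A ∈ s) :
      ((t.bipartiteAbove (fun A p => p.1 ⬝ᵥ A *ᵥ p.2 = 0) A).card : ℚ) =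
        (q ^ (n - k) - 1) * (q ^ m - 1) + (q ^ n - q ^ (n - k)) * (q ^ (m - 1) - 1) := by
    have hA' : A.rank = k := by simpa [hs] using hA
    rw [Finset.bipartiteAbove, ht, Finset.filter_filter, card_pairs_dotProduct_mulVec_eq_zero, hA']
  have hbelow (p) (hp : p ∈ t) :
      (s.bipartiteBelow (fun A p => p.1 ⬝ᵥ A *ᵥ p.2 = 0) p).card = c := by
    have hp' : p.1 ≠ 0 ∧ p.2 ≠ 0 := by simpa [ht] using hp
    rw [Finset.bipartiteBelow, hs, Finset.filter_filter, ← Fintype.card_subtype,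
      ← Nat.card_eq_fintype_card, hc]
    exact le_antisymm (card_rank_dotProduct_le k hp'.1 hu₀ hp'.2 hv₀)
      (card_rank_dotProduct_le k hu₀ hp'.1 hv₀ hp'.2)
  have hcount := congrArg (Nat.cast : ℕ → ℚ)
    (Finset.sum_card_bipartiteAbove_eq_sum_card_bipartiteBelow (s := s) (t := t)
      fun A p => p.1 ⬝ᵥ A *ᵥ p.2 = 0)
  rw [Finset.sum_congr rfl hbelow] at hcount
  push_cast at hcount
  rw [Finset.sum_congr rfl habove, Finset.sum_const, Finset.sum_const, nsmul_eq_mul, nsmul_eq_mul,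
    htcard] at hcount
  rw [hscard, mul_div_assoc', eq_div_iff (mul_ne_zero hqn hqm), mul_comm, ← hcount]
  obtain ⟨m, rfl⟩ := Nat.exists_eq_add_of_le' hm
  rw [Nat.add_sub_cancel]
  ring
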